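/- Let f_m ∈ 𝓡(m) and let φ : 𝐦_e → 𝐧_e be a doubly based map with φ_*f_m ∈ 𝓡(n). Let φ = p ∘ σ be the canonical decomposition of φ, with σ : 𝐦_e → 𝐤_e singular and p : 𝐤_e → 𝐧_e effective. Then σ_*f_m ∈ 𝓡(k). -/

import Mathlib

open MvPolynomial

/-- `f ∈ 𝓡(n)`: `f` is a sum of distinct monic squarefree monomials of positive
degree: all coefficients of monomials in the support are `1`, all exponents are
`≤ 1`, and the constant coefficient vanishes. -/
def IsRPoly {n : ℕ} (f : MvPolynomial (Fin n) ℤ) : Prop :=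
  (∀ d ∈ f.support, f.coeff d = 1) ∧
  (∀ d ∈ f.support, ∀ i, d i ≤ 1) ∧
  f.coeff 0 = 0

/-- The doubly based set `𝐦_e = {0, e, 1, …, m}`: `Sum.inl i` is the element
`i+1 ∈ {1,…,m}`, `Sum.inr false` is `0` and `Sum.inr true` is `e`. -/
def BSet (m : ℕ) := Fin m ⊕ Bool

/-- A doubly based map sends `0 ↦ 0` and `e ↦ e`. -/
def IsBased {m n : ℕ} (φ : BSet m → BSet n) : Prop :=
  ∀ b : Bool, φ (Sum.inr b) = Sum.inr b

/-- `φ` is effective if `φ⁻¹(0) = {0}` and `φ⁻¹(e) = {e}`. -/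
def Effective {m n : ℕ} (φ : BSet m → BSet n) : Prop :=
  ∀ i : Fin m, ∃ j : Fin n, φ (Sum.inl i) = Sum.inl j

/-- `φ` is singular if it is surjective and is order preserving on the elements
of `{1,…,m}` not sent to a basepoint. -/
def Singular {m n : ℕ} (φ : BSet m → BSet n) : Prop :=
  Function.Surjective φ ∧
  ∀ i j : Fin m, i < j → ∀ pi pj : Fin n,
    φ (Sum.inl i) = Sum.inl pi → φ (Sum.inl j) = Sum.inl pj → pi < pj

/-- The pushforward of `f ∈ ℤ[a₁,…,a_m]` along a doubly based map
`φ : 𝐦_e → 𝐧_e`: substitute `a_{φ(i)}` for `a_i`, where `a_0 := 0`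
and `a_e := 1`. -/
noncomputable def bpush {m n : ℕ} (φ : BSet m → BSet n)
    (f : MvPolynomial (Fin m) ℤ) : MvPolynomial (Fin n) ℤ :=
  MvPolynomial.aeval (fun i : Fin m =>
    match φ (Sum.inl i) with
    | Sum.inl j => MvPolynomial.X j
    | Sum.inr false => 0
    | Sum.inr true => 1) f

theorem coeff_le_coeff_rename_of_nonneg {ι κ R : Type*} [CommSemiring R] [PartialOrder R]
    [IsOrderedRing R] (q : ι → κ) (g : MvPolynomial ι R) (hg : ∀ d, 0 ≤ g.coeff d) (d : ι →₀ ℕ) :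
    g.coeff d ≤ (rename q g).coeff (d.mapDomain q) := by
  classical
  have h : (rename q g).coeff (d.mapDomain q)
      = ∑ e ∈ g.support, if e.mapDomain q = d.mapDomain q then g.coeff e else 0 := by
    conv_lhs => rw [g.as_sum, map_sum, coeff_sum]
    simp only [rename_monomial, coeff_monomial]
  have hnonneg : ∀ e ∈ g.support,
      0 ≤ if e.mapDomain q = d.mapDomain q then g.coeff e else 0 := by
    intro e _
    split_ifs
    exacts [hg e, le_rfl]
  rw [h]
  by_cases hd : d ∈ g.support
  · simpa using Finset.single_le_sum hnonneg hd
  · rw [notMem_support_iff.mp hd]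
    exact Finset.sum_nonneg hnonneg

theorem IsRPoly.of_rename {k n : ℕ} {q : Fin k → Fin n} {g : MvPolynomial (Fin k) ℤ}
    (hg : ∀ d, 0 ≤ g.coeff d) (h : IsRPoly (rename q g)) : IsRPoly g := by
  obtain ⟨hone, hsq, hzero⟩ := h
  have hle := coeff_le_coeff_rename_of_nonneg q g hg
  have hpos : ∀ d ∈ g.support, 0 < g.coeff d := fun d hd =>
    lt_of_le_of_ne (hg d) (mem_support_iff.mp hd).symm
  have hmem : ∀ d ∈ g.support, d.mapDomain q ∈ (rename q g).support := fun d hd =>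
    mem_support_iff.mpr ((hpos d hd).trans_le (hle d)).ne'
  refine ⟨fun d hd => le_antisymm ((hle d).trans_eq (hone _ (hmem d hd))) (hpos d hd),
    fun d hd i => le_trans ?_ (hsq _ (hmem d hd) (q i)), le_antisymm ?_ (hg 0)⟩
  · rw [← Finsupp.single_add_erase i d, Finsupp.mapDomain_add, Finsupp.mapDomain_single]
    simp
  · simpa [hzero] using hle 0

theorem coeff_aeval_nonneg {ι κ : Type*} {f : MvPolynomial ι ℤ} {F : ι → MvPolynomial κ ℤ}
    (hf : ∀ d, 0 ≤ f.coeff d) (hF : ∀ i, F i ∈ (map (σ := κ) (Nat.castRingHom ℤ)).rangeS)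
    (d : κ →₀ ℕ) : 0 ≤ (aeval F f).coeff d := by
  have h : aeval F f ∈ (map (σ := κ) (Nat.castRingHom ℤ)).rangeS := by
    rw [aeval_def, eval₂_eq]
    refine sum_mem fun e _ => mul_mem ?_ (prod_mem fun i _ => pow_mem (hF i) _)
    obtain ⟨c, hc⟩ := Int.eq_ofNat_of_zero_le (hf e)
    exact ⟨C c, by simp [hc]⟩
  obtain ⟨g, hg⟩ := h
  rw [← hg, coeff_map]
  simp

theorem coeff_bpush_nonneg {m k : ℕ} (σ : BSet m → BSet k) {f : MvPolynomial (Fin m) ℤ}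
    (hf : ∀ d, 0 ≤ f.coeff d) (d : Fin k →₀ ℕ) : 0 ≤ (bpush σ f).coeff d := by
  refine coeff_aeval_nonneg hf (fun i => ?_) d
  split
  exacts [⟨X _, map_X _ _⟩, zero_mem _, one_mem _]

theorem bpush_comp_eq_rename {m k n : ℕ} (σ : BSet m → BSet k) {p : BSet k → BSet n}
    (hp : IsBased p) {q : Fin k → Fin n} (hq : ∀ i, p (Sum.inl i) = Sum.inl (q i))
    (f : MvPolynomial (Fin m) ℤ) : bpush (p ∘ σ) f = rename q (bpush σ f) := by
  unfold bpush
  rw [← AlgHom.comp_apply, comp_aeval]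
  congr 2
  funext i
  have hcomp : (p ∘ σ) (Sum.inl i) = p (σ (Sum.inl i)) := rfl
  rw [hcomp]
  rcases σ (Sum.inl i) with j | _ | _
  · simp [hq j]
  · simp [hp false]
  · simp [hp true]

/-- If `f_m ∈ 𝓡(m)`, `φ` is doubly based with `φ_* f_m ∈ 𝓡(n)`, and
`φ = p ∘ σ` is the canonical decomposition (`σ` singular, `p` effective),
then `σ_* f_m ∈ 𝓡(k)`. -/
theorem isRPoly_singular_part (m n k : ℕ) (f : MvPolynomial (Fin m) ℤ)
    (hf : IsRPoly f)
    (φ : BSet m → BSet n) (hφ : IsBased φ) (hpush : IsRPoly (bpush φ f))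
    (σ : BSet m → BSet k) (p : BSet k → BSet n)
    (hσb : IsBased σ) (hpb : IsBased p) (hσ : Singular σ) (hp : Effective p)
    (hdec : φ = p ∘ σ) :
    IsRPoly (bpush σ f) := by
  choose q hq using hp
  rw [hdec, bpush_comp_eq_rename σ hpb hq] at hpush
  refine hpush.of_rename (coeff_bpush_nonneg σ fun d => ?_)
  by_cases hd : d ∈ f.support
  · exact (hf.1 d hd).symm ▸ zero_le_one
  · exact (notMem_support_iff.mp hd).ge
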